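/- Let T : X → X be a continuous map of a compact metric space (X,d), let (ξ_n) be a sequence of T-periodic points with periods π_n, let x_n ∈ X^ℕ be the orbit sequence (ξ_n, T(ξ_n), T²(ξ_n), …), and let ν_n := (1/π_n) Σ_{ℓ=0}^{π_n−1} δ_{T^ℓ(ξ_n)}. If the sequence (x_n) is F̄_K-Cauchy (for every ε > 0 there is n_0 with F̄_K(x_n, x_m) < ε for all m, n ≥ n_0), then there exists a T-invariant probability measure ν on X such that ν_n → ν in the weak-star topology, ν is ergodic, and the measure-theoretic entropy satisfies h_ν(T) = 0. -/

import Mathlib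

open MeasureTheory Filter Set
open scoped ENNReal NNReal

noncomputable section

/-- An `(n,δ)`-match between the sequences `x` and `y`, for the distance function `d`:
an order-preserving bijection `p` from `D` onto `R`, with `D, R ⊆ {0, …, n-1}`, such that
`d (x i) (y (p i)) < δ` for all `i ∈ D`.  The fit size of the match is `D.card`. -/
def IsMatch {X : Type*} (d : X → X → ℝ) (x y : ℕ → X) (n : ℕ) (δ : ℝ)
    (D R : Finset ℕ) (p : ℕ → ℕ) : Prop :=
  (∀ i ∈ D, i < n) ∧ (∀ j ∈ R, j < n) ∧ Set.BijOn p ↑D ↑R ∧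
  (∀ i ∈ D, ∀ j ∈ D, i < j → p i < p j) ∧ (∀ i ∈ D, d (x i) (y (p i)) < δ)

/-- The maximal fit size of an `(n,δ)`-match between `x` and `y`. -/
def maxFit {X : Type*} (d : X → X → ℝ) (x y : ℕ → X) (n : ℕ) (δ : ℝ) : ℕ :=
  sSup {m : ℕ | ∃ D R p, IsMatch d x y n δ D R p ∧ D.card = m}

/-- The `(n,δ)`-gap function `f̄_{n,δ}(x,y)`. -/
def gapFn {X : Type*} (d : X → X → ℝ) (x y : ℕ → X) (n : ℕ) (δ : ℝ) : ℝ :=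
  1 - (maxFit d x y n δ : ℝ) / n

/-- The `f̄_δ`-pseudo-distance: `f̄_δ(x,y) = limsup_n f̄_{n,δ}(x,y)`. -/
def gapDist {X : Type*} (d : X → X → ℝ) (x y : ℕ → X) (δ : ℝ) : ℝ :=
  Filter.limsup (fun n => gapFn d x y n δ) Filter.atTop

/-- The Feldman–Katok pseudometric `F̄_K(x,y) = inf {δ > 0 : f̄_δ(x,y) < δ}`. -/
def FKdist {X : Type*} (d : X → X → ℝ) (x y : ℕ → X) : ℝ :=
  sInf {δ : ℝ | 0 < δ ∧ gapDist d x y δ < δ}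


/-- Weak-star convergence of a sequence of measures. -/
def WeakStarTendsto {X : Type*} [TopologicalSpace X] [MeasurableSpace X]
    (μs : ℕ → Measure X) (μ : Measure X) : Prop :=
  ∀ g : C(X, ℝ), Tendsto (fun n => ∫ x, g x ∂(μs n)) atTop (nhds (∫ x, g x ∂μ))

/-- The Kolmogorov–Sinai (measure-theoretic) entropy of `T` with respect to `μ`:
the supremum, over all finite measurable colorings `c : X → Fin m`, of the entropy of the
associated process, the latter computed (via subadditivity) as `inf_n H_n/n` where `H_n`
is the Shannon entropy of the partition of `X` by the itineraries
`(c x, c (T x), …, c (T^{n-1} x))`. -/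
def ksEntropy {X : Type*} [MeasurableSpace X] (T : X → X) (μ : Measure X) : ℝ≥0∞ :=
  ⨆ (m : ℕ) (c : {c : X → Fin m // Measurable c}),
    ⨅ n : ℕ, ENNReal.ofReal
      ((∑ s : Fin (n + 1) → Fin m,
        Real.negMulLog ((μ {x | ∀ i : Fin (n + 1), c.1 (T^[(i : ℕ)] x) = s i}).toReal))
        / ((n : ℝ) + 1))

/-! ### Monotone time changes -/

/-- The cost at time `i` of shadowing the orbit of `x` by the orbit of `y` along the time change
`φ`: the deviation of `φ` from a translation, plus the tracing error. -/
def stepCost {X : Type*} [Dist X] (T : X → X) (y x : X) (φ : ℕ → ℕ) (i : ℕ) : ℝ :=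
  |(φ (i + 1) : ℝ) - φ i - 1| + dist (T^[i] x) (T^[φ i] y)

/-- The least cost of shadowing the first `L` points of the orbit of `x` by the orbit of `y`
along a monotone time change. -/
def warpCost {X : Type*} [Dist X] (T : X → X) (y : X) (L : ℕ) (x : X) : ℝ :=
  ⨅ φ : {φ : ℕ → ℕ // Monotone φ}, ∑ i ∈ Finset.range L, stepCost T y x φ.1 i

instance nonempty_monotone_nat : Nonempty {φ : ℕ → ℕ // Monotone φ} := ⟨⟨id, monotone_id⟩⟩

section Warp

variable {X : Type*} [MetricSpace X] {T : X → X}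

lemma stepCost_nonneg (y x : X) (φ : ℕ → ℕ) (i : ℕ) : 0 ≤ stepCost T y x φ i := by
  unfold stepCost; positivity

lemma warpCost_le (y : X) (L : ℕ) (x : X) {φ : ℕ → ℕ} (hφ : Monotone φ) :
    warpCost T y L x ≤ ∑ i ∈ Finset.range L, stepCost T y x φ i :=
  ciInf_le (f := fun φ : {φ : ℕ → ℕ // Monotone φ} =>
      ∑ i ∈ Finset.range L, stepCost T y x φ.1 i)
    ⟨0, by rintro _ ⟨φ, rfl⟩; exact Finset.sum_nonneg fun _ _ => stepCost_nonneg _ _ _ _⟩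
    ⟨φ, hφ⟩

lemma warpCost_le_add (y : X) (L : ℕ) (x x' : X) :
    warpCost T y L x ≤
      warpCost T y L x' + ∑ i ∈ Finset.range L, dist (T^[i] x) (T^[i] x') := by
  rw [← sub_le_iff_le_add]
  refine le_ciInf fun φ => ?_
  rw [sub_le_iff_le_add]
  refine (warpCost_le y L x φ.2).trans ?_
  rw [← Finset.sum_add_distrib]
  refine Finset.sum_le_sum fun i _ => ?_
  unfold stepCost
  linarith [dist_triangle (T^[i] x) (T^[i] x') (T^[φ.1 i] y)]

lemma continuous_warpCost (hT : Continuous T) (y : X) (L : ℕ) :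
    Continuous (warpCost T y L) := by
  refine continuous_iff_continuousAt.2 fun x₀ => ?_
  have hD : Tendsto (fun x => ∑ i ∈ Finset.range L, dist (T^[i] x) (T^[i] x₀)) (nhds x₀)
      (nhds 0) := by
    have hc : Continuous fun x => ∑ i ∈ Finset.range L, dist (T^[i] x) (T^[i] x₀) :=
      continuous_finsetSum _ fun i _ => (hT.iterate i).dist continuous_const
    simpa using hc.tendsto x₀
  rw [ContinuousAt, tendsto_iff_dist_tendsto_zero]
  refine squeeze_zero (fun _ => dist_nonneg) (fun x => ?_) hD
  rw [Real.dist_eq, abs_sub_le_iff]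
  constructor
  · linarith [warpCost_le_add (T := T) y L x x₀]
  · have h := warpCost_le_add (T := T) y L x₀ x
    simp only [dist_comm (T^[_] x₀)] at h
    linarith

/-- The first value of a match at or after time `i`, or the horizon `N` if there is none, is a
monotone time change whose total cost is controlled by the number of unmatched times. -/
lemma exists_monotone_sum_stepCost_le {C : ℝ} (hC : ∀ x y : X, dist x y ≤ C) (y x : X)
    {N : ℕ} {δ : ℝ} (hδ : 0 ≤ δ) {D R : Finset ℕ} {p : ℕ → ℕ}
    (h : IsMatch dist (fun i => T^[i] x) (fun i => T^[i] y) N δ D R p) :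
    ∃ φ : ℕ → ℕ, Monotone φ ∧
      ∑ i ∈ Finset.range N, stepCost T y x φ i ≤ (2 + C) * (N - D.card) + N * δ := by
  obtain ⟨hD, hR, hbij, hmono, hdist⟩ := h
  have hpR : ∀ i ∈ D, p i < N := fun i hi => hR _ (hbij.mapsTo hi)
  set A : ℕ → Set ℕ := fun i => {j | ∃ k ∈ D, i ≤ k ∧ p k = j} ∪ {N} with hA
  set φ : ℕ → ℕ := fun i => sInf (A i) with hφ
  have hne : ∀ i, (A i).Nonempty := fun i => ⟨N, Or.inr rfl⟩
  have hle : ∀ i, φ i ≤ N := fun i => Nat.sInf_le (Or.inr rfl)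
  have hsub : ∀ i j, i ≤ j → A j ⊆ A i := by
    rintro i j hij l (⟨k, hk, hjk, rfl⟩ | rfl)
    · exact Or.inl ⟨k, hk, hij.trans hjk, rfl⟩
    · exact Or.inr rfl
  have hφm : Monotone φ := fun i j hij => Nat.sInf_le (hsub i j hij (Nat.sInf_mem (hne j)))
  have hφD : ∀ i ∈ D, φ i = p i := by
    intro i hi
    apply le_antisymm (Nat.sInf_le (Or.inl ⟨i, hi, le_rfl, rfl⟩))
    rcases Nat.sInf_mem (hne i) with ⟨k, hk, hik, hpk⟩ | hN
    · change p i ≤ sInf (A i)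
      rw [← hpk]
      rcases hik.eq_or_lt with rfl | hlt
      · exact le_rfl
      · exact (hmono i hi k hk hlt).le
    · change p i ≤ sInf (A i)
      rw [hN]; exact (hpR i hi).le
  have hφD' : ∀ i ∈ D, φ i + 1 ≤ φ (i + 1) := by
    intro i hi
    rw [hφD i hi]
    rcases Nat.sInf_mem (hne (i + 1)) with ⟨k, hk, hik, hpk⟩ | hN
    · change p i + 1 ≤ sInf (A (i + 1))
      rw [← hpk]; exact hmono i hi k hk hik
    · change p i + 1 ≤ sInf (A (i + 1))
      rw [hN]; exact hpR i hi
  have hφn : ∀ i ∉ D, φ (i + 1) = φ i := by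
    intro i hi
    apply le_antisymm _ (hφm i.le_succ)
    apply Nat.sInf_le
    rcases Nat.sInf_mem (hne i) with ⟨k, hk, hik, hpk⟩ | hN
    · refine Or.inl ⟨k, hk, ?_, hpk⟩
      exact Nat.succ_le_of_lt (lt_of_le_of_ne hik fun h => hi (h ▸ hk))
    · exact Or.inr hN
  refine ⟨φ, hφm, ?_⟩
  have hC0 : 0 ≤ C := dist_nonneg.trans (hC x x)
  have hstep : ∀ i ∈ Finset.range N, stepCost T y x φ i ≤
      ((φ (i + 1) : ℝ) - φ i) + (2 + C - 1) + δ - (if i ∈ D then 2 + C else 0) := by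
    intro i _
    unfold stepCost
    by_cases hi : i ∈ D
    · have h1 : (φ i : ℝ) + 1 ≤ φ (i + 1) := by exact_mod_cast hφD' i hi
      have h2 := hdist i hi
      rw [← hφD i hi] at h2
      rw [abs_of_nonneg (by linarith), if_pos hi]
      linarith
    · rw [hφn i hi, if_neg hi]
      have := hC (T^[i] x) (T^[φ i] y)
      simp only [sub_self, zero_sub, abs_neg, abs_one]
      linarith
  refine (Finset.sum_le_sum hstep).trans ?_
  have hcard : ∑ i ∈ Finset.range N, (if i ∈ D then 2 + C else 0) = D.card * (2 + C) := by
    rw [← Finset.sum_filter, Finset.sum_const, nsmul_eq_mul]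
    congr 3
    ext i
    simpa using hD i
  rw [Finset.sum_sub_distrib, Finset.sum_add_distrib, Finset.sum_add_distrib,
    Finset.sum_range_sub (fun i => (φ i : ℝ)), hcard]
  simp only [Finset.sum_const, Finset.card_range, nsmul_eq_mul]
  have h1 : (φ N : ℝ) ≤ N := by exact_mod_cast hle N
  have h2 : (0 : ℝ) ≤ φ 0 := by positivity
  nlinarith

end Warp

/-! ### From the Feldman–Katok pseudometric to matches -/

lemma exists_isMatch_card_eq_maxFit {X : Type*} (d : X → X → ℝ) (x y : ℕ → X) (n : ℕ) (δ : ℝ) :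
    ∃ D R p, IsMatch d x y n δ D R p ∧ D.card = maxFit d x y n δ := by
  have hne : {m : ℕ | ∃ D R p, IsMatch d x y n δ D R p ∧ D.card = m}.Nonempty :=
    ⟨0, ∅, ∅, id, by simp [IsMatch], rfl⟩
  refine Nat.sSup_mem hne ⟨n, ?_⟩
  rintro _ ⟨D, R, p, h, rfl⟩
  simpa using Finset.card_le_card (fun i hi => Finset.mem_range.2 (h.1 i hi) : D ⊆ Finset.range n)

lemma eventually_exists_isMatch_of_FKdist_lt {X : Type*} {d : X → X → ℝ} {x y : ℕ → X} {ε : ℝ}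
    (h : FKdist d x y < ε) :
    ∀ᶠ n : ℕ in atTop, ∃ D R p, IsMatch d x y n ε D R p ∧ (1 - ε) * n ≤ D.card := by
  have hle : ∀ δ n, gapFn d x y n δ ≤ 1 := fun δ n => by
    unfold gapFn
    have : (0 : ℝ) ≤ (maxFit d x y n δ : ℝ) / n := by positivity
    linarith
  have hne : {δ : ℝ | 0 < δ ∧ gapDist d x y δ < δ}.Nonempty := by
    refine ⟨2, two_pos, lt_of_le_of_lt ?_ one_lt_two⟩
    refine limsup_le_of_le ?_ (Eventually.of_forall (hle 2))
    refine IsBoundedUnder.isCoboundedUnder_le ⟨-1, ?_⟩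
    rw [eventually_map]
    refine Eventually.of_forall fun n => ?_
    obtain ⟨D, R, p, hm, hc⟩ := exists_isMatch_card_eq_maxFit d x y n 2
    have hcn : D.card ≤ n := by
      simpa using Finset.card_le_card
        (fun i hi => Finset.mem_range.2 (hm.1 i hi) : D ⊆ Finset.range n)
    have : (maxFit d x y n 2 : ℝ) / n ≤ 1 := by
      rw [← hc]
      exact div_le_one_of_le₀ (by exact_mod_cast hcn) (by positivity)
    change -1 ≤ gapFn d x y n 2
    unfold gapFn
    linarith
  obtain ⟨δ, ⟨hδ, hgap⟩, hδε⟩ := exists_lt_of_csInf_lt hne h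
  have hev : ∀ᶠ n in atTop, gapFn d x y n δ < δ :=
    eventually_lt_of_limsup_lt hgap
      ⟨1, by rw [eventually_map]; exact Eventually.of_forall (hle δ)⟩
  filter_upwards [hev, eventually_gt_atTop 0] with n hn hn0
  obtain ⟨D, R, p, hm, hc⟩ := exists_isMatch_card_eq_maxFit d x y n δ
  refine ⟨D, R, p, ⟨hm.1, hm.2.1, hm.2.2.1, hm.2.2.2.1,
    fun i hi => (hm.2.2.2.2 i hi).trans hδε⟩, ?_⟩
  have hn0' : (0 : ℝ) < n := by exact_mod_cast hn0
  unfold gapFn at hn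
  rw [← hc] at hn
  have : 1 - ε ≤ (D.card : ℝ) / n := by linarith
  rwa [le_div_iff₀ hn0'] at this

/-! ### Averages along periodic orbits -/

/-- The average of `g` over the first `P` points of the orbit of `y`. -/
def orbitAvg {X : Type*} (T : X → X) (y : X) (P : ℕ) (g : X → ℝ) : ℝ :=
  (∑ j ∈ Finset.range P, g (T^[j] y)) / P

section Average

variable {X : Type*} {T : X → X}

lemma sum_range_mul_of_iterate_eq {y : X} {P : ℕ} (hy : T^[P] y = y) (g : X → ℝ) (k : ℕ) :
    ∑ j ∈ Finset.range (k * P), g (T^[j] y) = k * ∑ j ∈ Finset.range P, g (T^[j] y) := by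
  induction k with
  | zero => simp
  | succ k ih =>
    have hk : T^[k * P] y = y := by
      rw [mul_comm, Function.iterate_mul]
      exact Function.iterate_fixed hy k
    rw [Nat.succ_mul, Finset.sum_range_add, ih]
    have : ∀ j, T^[k * P + j] y = T^[j] y := fun j => by
      rw [add_comm, Function.iterate_add_apply, hk]
    simp only [this]
    push_cast
    ring

lemma orbitAvg_shift {y : X} {P : ℕ} (hy : T^[P] y = y) (g : X → ℝ) :
    orbitAvg T y P (fun x => g (T x)) = orbitAvg T y P g := by
  unfold orbitAvg
  congr 1
  have h1 := Finset.sum_range_succ (fun j => g (T^[j] y)) P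
  have h2 := Finset.sum_range_succ' (fun j => g (T^[j] y)) P
  simp only [hy, Function.iterate_succ_apply', Function.iterate_zero, id_eq] at h1 h2
  linarith

lemma abs_sum_range_le {M : ℝ} {g : X → ℝ} (hM : ∀ x, |g x| ≤ M) (y : X) (n : ℕ) :
    |∑ j ∈ Finset.range n, g (T^[j] y)| ≤ n * M := by
  refine (Finset.abs_sum_le_sum_abs _ _).trans ?_
  refine (Finset.sum_le_sum fun j _ => hM _).trans ?_
  simp

lemma abs_orbitAvg_le {M : ℝ} {g : X → ℝ} (hM : ∀ x, |g x| ≤ M) (y : X) {P : ℕ} (hP : 0 < P) :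
    |orbitAvg T y P g| ≤ M := by
  have hP' : (0 : ℝ) < P := by exact_mod_cast hP
  unfold orbitAvg
  rw [abs_div, abs_of_pos hP', div_le_iff₀ hP', mul_comm]
  exact abs_sum_range_le hM y P

lemma abs_sum_range_sub_orbitAvg_le {M : ℝ} {g : X → ℝ} (hM : ∀ x, |g x| ≤ M) {y : X} {P : ℕ}
    (hP : 0 < P) (hy : T^[P] y = y) (n : ℕ) :
    |∑ j ∈ Finset.range n, g (T^[j] y) - n * orbitAvg T y P g| ≤ 2 * P * M := by
  have hP' : (0 : ℝ) < P := by exact_mod_cast hP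
  have hM0 : 0 ≤ M := (abs_nonneg _).trans (hM y)
  obtain ⟨q, r, hr, rfl⟩ : ∃ q r, r < P ∧ n = q * P + r :=
    ⟨n / P, n % P, Nat.mod_lt _ hP, by rw [mul_comm]; exact (Nat.div_add_mod n P).symm⟩
  have hk : T^[q * P] y = y := by
    rw [mul_comm, Function.iterate_mul]
    exact Function.iterate_fixed hy q
  have hS : ∑ j ∈ Finset.range P, g (T^[j] y) = P * orbitAvg T y P g := by
    unfold orbitAvg; field_simp
  have : ∀ j, T^[q * P + j] y = T^[j] y := fun j => by
    rw [add_comm, Function.iterate_add_apply, hk]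
  rw [Finset.sum_range_add, sum_range_mul_of_iterate_eq hy, hS]
  simp only [this]
  have h1 := abs_le.1 (abs_sum_range_le (T := T) hM y r)
  have h2 := abs_le.1 (abs_orbitAvg_le (T := T) hM y hP)
  have hr' : (r : ℝ) ≤ P := by exact_mod_cast hr.le
  have hr0 : (0 : ℝ) ≤ r := by positivity
  push_cast
  rw [abs_le]
  constructor <;> nlinarith

end Average

section Shadowing

variable {X : Type*} [MetricSpace X] {T : X → X}

/-- Birkhoff sums are controlled by the cost of shadowing a periodic orbit. -/
lemma abs_sum_range_sub_le_warpCost {M η K : ℝ} {g : X → ℝ} (hM : ∀ x, |g x| ≤ M)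
    (hK : 0 ≤ K) (hg : ∀ x y, |g x - g y| ≤ η + K * dist x y) {y : X} {P : ℕ}
    (hP : 0 < P) (hy : T^[P] y = y) (L : ℕ) (x : X) :
    |∑ i ∈ Finset.range L, g (T^[i] x) - L * orbitAvg T y P g| ≤
      η * L + (K + 2 * M) * warpCost T y L x + 4 * P * M := by
  have hM0 : 0 ≤ M := (abs_nonneg _).trans (hM y)
  rcases (add_nonneg hK (mul_nonneg zero_le_two hM0)).eq_or_lt with h0 | hpos
  · have hM' : M = 0 := by linarith
    have hg0 : ∀ x, g x = 0 := fun x => abs_nonpos_iff.1 ((hM x).trans hM'.le)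
    have hη : 0 ≤ η := by simpa using hg y y
    simp only [hg0, orbitAvg, hM', Finset.sum_const_zero]
    simp only [hM'] at h0
    have hK0 : K = 0 := by linarith
    simp only [hK0]
    simp
    positivity
  set c := orbitAvg T y P g with hc
  have hcM : |c| ≤ M := abs_orbitAvg_le hM y hP
  set G : ℕ → ℝ := fun n => ∑ j ∈ Finset.range n, g (T^[j] y) with hG
  suffices h : ∀ φ : {φ : ℕ → ℕ // Monotone φ},
      (|∑ i ∈ Finset.range L, g (T^[i] x) - L * c| - η * L - 4 * P * M) / (K + 2 * M) ≤
        ∑ i ∈ Finset.range L, stepCost T y x φ.1 i by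
    have := le_ciInf h
    rw [div_le_iff₀ hpos] at this
    unfold warpCost
    linarith
  rintro ⟨φ, hφ⟩
  rw [div_le_iff₀ hpos]
  change _ ≤ (∑ i ∈ Finset.range L, stepCost T y x φ i) * _
  set J : ℕ → ℝ := fun i => |(φ (i + 1) : ℝ) - φ i - 1| with hJ
  have hGstep : ∀ i, |G (φ (i + 1)) - G (φ i) - g (T^[φ i] y)| ≤ M * J i := by
    intro i
    rcases (hφ i.le_succ).eq_or_lt with h | h
    · simp only [hJ, Nat.succ_eq_add_one] at h ⊢
      rw [← h]
      simpa using hM _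
    · obtain ⟨k, hk⟩ := Nat.exists_eq_add_of_lt h
      rw [Nat.succ_eq_add_one] at hk
      have h1 : G (φ (i + 1)) - G (φ i) - g (T^[φ i] y) =
          ∑ j ∈ Finset.range k, g (T^[j] (T^[φ i + 1] y)) := by
        simp only [hG]
        rw [hk, add_assoc, add_comm k 1, ← add_assoc, Finset.sum_range_add,
          Finset.sum_range_succ]
        simp only [← Function.iterate_add_apply]
        simp only [add_comm]
        ring
      have h2 : J i = k := by
        simp only [hJ, hk]
        push_cast
        rw [show (φ i : ℝ) + k + 1 - φ i - 1 = k by ring]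
        simp
      rw [h1, h2, mul_comm]
      exact abs_sum_range_le hM _ k
  have hsum1 : |∑ i ∈ Finset.range L, g (T^[i] x) - (G (φ L) - G (φ 0))| ≤
      ∑ i ∈ Finset.range L, (η + K * dist (T^[i] x) (T^[φ i] y) + M * J i) := by
    rw [← Finset.sum_range_sub (fun i => G (φ i)), ← Finset.sum_sub_distrib]
    refine (Finset.abs_sum_le_sum_abs _ _).trans (Finset.sum_le_sum fun i _ => ?_)
    have h1 := abs_le.1 (hg (T^[i] x) (T^[φ i] y))
    have h2 := abs_le.1 (hGstep i)
    rw [abs_le]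
    constructor <;> linarith
  have hsum2 : |(φ L : ℝ) - φ 0 - L| ≤ ∑ i ∈ Finset.range L, J i := by
    have : (φ L : ℝ) - φ 0 - L = ∑ i ∈ Finset.range L, ((φ (i + 1) : ℝ) - φ i - 1) := by
      rw [Finset.sum_sub_distrib, Finset.sum_range_sub (fun i => (φ i : ℝ))]
      simp
    rw [this]
    exact Finset.abs_sum_le_sum_abs _ _
  have h3 : |c * ((φ L : ℝ) - φ 0 - L)| ≤ M * ∑ i ∈ Finset.range L, J i := by
    rw [abs_mul]
    exact mul_le_mul hcM hsum2 (abs_nonneg _) hM0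
  have h4 := abs_le.1 (abs_sum_range_sub_orbitAvg_le hM hP hy (φ L))
  have h5 := abs_le.1 (abs_sum_range_sub_orbitAvg_le hM hP hy (φ 0))
  rw [← hc] at h4 h5
  change -(2 * P * M) ≤ G (φ L) - _ ∧ G (φ L) - _ ≤ _ at h4
  change -(2 * P * M) ≤ G (φ 0) - _ ∧ G (φ 0) - _ ≤ _ at h5
  have hmain : ∑ i ∈ Finset.range L, (η + K * dist (T^[i] x) (T^[φ i] y) + M * J i) +
      M * ∑ i ∈ Finset.range L, J i ≤
      η * L + (K + 2 * M) * ∑ i ∈ Finset.range L, stepCost T y x φ i := by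
    have : η * L = ∑ i ∈ Finset.range L, η := by simp [mul_comm]
    rw [this, Finset.mul_sum, Finset.mul_sum, ← Finset.sum_add_distrib, ← Finset.sum_add_distrib]
    refine Finset.sum_le_sum fun i _ => ?_
    unfold stepCost
    have hJ0 : 0 ≤ J i := abs_nonneg _
    have hd0 : 0 ≤ dist (T^[i] x) (T^[φ i] y) := dist_nonneg
    change _ ≤ η + (K + 2 * M) * (J i + _)
    nlinarith [mul_nonneg hK hJ0, mul_nonneg hM0 hd0]
  have hfin : |∑ i ∈ Finset.range L, g (T^[i] x) - L * c| ≤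
      ∑ i ∈ Finset.range L, (η + K * dist (T^[i] x) (T^[φ i] y) + M * J i) +
      M * ∑ i ∈ Finset.range L, J i + 4 * P * M := by
    have h1 := abs_le.1 hsum1
    have h3 := abs_le.1 h3
    rw [abs_le]
    constructor <;> linarith
  linarith

/-- The average cost of shadowing along a periodic orbit is controlled by the Feldman–Katok
pseudometric. -/
lemma orbitAvg_warpCost_le {C ε : ℝ} (hC : ∀ x y : X, dist x y ≤ C) {x y : X} {P : ℕ}
    (hP : 0 < P) (hx : T^[P] x = x)
    (h : FKdist dist (fun i => T^[i] x) (fun i => T^[i] y) < ε) (L : ℕ) :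
    orbitAvg T x P (warpCost T y L) ≤ (3 + C) * ε * L := by
  have hP' : (0 : ℝ) < P := by exact_mod_cast hP
  have hε : 0 < ε := lt_of_le_of_lt (Real.sInf_nonneg fun δ hδ => hδ.1.le) h
  set S := ∑ j ∈ Finset.range P, warpCost T y L (T^[j] x) with hS
  have hC0 : 0 ≤ C := dist_nonneg.trans (hC x x)
  have hbound : ∀ᶠ k : ℕ in atTop,
      (k : ℝ) * S ≤ (3 + C) * ε * L * (k * P + L) := by
    have htend : Tendsto (fun k : ℕ => k * P + L) atTop atTop :=
      tendsto_atTop_mono (fun k => (Nat.le_mul_of_pos_right k hP).trans (Nat.le_add_right _ L))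
        tendsto_id
    filter_upwards [htend.eventually (eventually_exists_isMatch_of_FKdist_lt h)] with k hk
    obtain ⟨D, R, p, hm, hcard⟩ := hk
    obtain ⟨φ, hφ, hcost⟩ := exists_monotone_sum_stepCost_le hC y x hε.le hm
    rw [hS, ← sum_range_mul_of_iterate_eq hx]
    have h1 : ∀ j ∈ Finset.range (k * P), warpCost T y L (T^[j] x) ≤
        ∑ i ∈ Finset.range L, stepCost T y x φ (i + j) := by
      intro j _
      refine (warpCost_le (φ := fun i => φ (i + j)) y L _
        (fun a b hab => hφ (by omega))).trans (le_of_eq ?_)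
      refine Finset.sum_congr rfl fun i _ => ?_
      unfold stepCost
      rw [Function.iterate_add_apply, add_right_comm]
    refine (Finset.sum_le_sum h1).trans ?_
    rw [Finset.sum_comm]
    have h2 : ∀ i ∈ Finset.range L, ∑ j ∈ Finset.range (k * P), stepCost T y x φ (i + j) ≤
        (3 + C) * ε * (k * P + L) := by
      intro i hi
      have : ∑ j ∈ Finset.range (k * P), stepCost T y x φ (i + j) ≤
          ∑ j ∈ Finset.range (k * P + L), stepCost T y x φ j := by
        have h3 : ∑ j ∈ Finset.range (i + k * P), stepCost T y x φ j ≤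
          ∑ j ∈ Finset.range (k * P + L), stepCost T y x φ j := by
          refine Finset.sum_le_sum_of_subset_of_nonneg ?_ fun _ _ _ => stepCost_nonneg _ _ _ _
          rw [Finset.mem_range] at hi
          exact Finset.range_mono (by omega)
        rw [Finset.sum_range_add] at h3
        have : 0 ≤ ∑ j ∈ Finset.range i, stepCost T y x φ j :=
          Finset.sum_nonneg fun _ _ => stepCost_nonneg _ _ _ _
        linarith
      refine this.trans (hcost.trans ?_)
      push_cast at hcard ⊢
      nlinarith
    refine (Finset.sum_le_sum h2).trans (le_of_eq ?_)
    simp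
    ring
  have hlim : S ≤ (3 + C) * ε * L * P := by
    have ht : Tendsto (fun k : ℕ => (3 + C) * ε * L * (P + L / (k : ℝ))) atTop
        (nhds ((3 + C) * ε * L * (P + 0))) :=
      (tendsto_const_nhds.add (tendsto_const_div_atTop_nhds_zero_nat _)).const_mul _
    rw [add_zero] at ht
    refine ge_of_tendsto ht ?_
    filter_upwards [hbound, eventually_gt_atTop 0] with k hk hk0
    have hk0' : (0 : ℝ) < k := by exact_mod_cast hk0
    refine le_of_mul_le_mul_left (hk.trans (le_of_eq ?_)) hk0'
    field_simp
  unfold orbitAvg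
  rwa [div_le_iff₀ hP']

end Shadowing

/-! ### The limit measure -/

section Limit

lemma exists_abs_sub_le_add_mul_dist {X : Type*} [MetricSpace X] [CompactSpace X]
    (g : C(X, ℝ)) {η : ℝ} (hη : 0 < η) :
    ∃ K : ℝ, 0 ≤ K ∧ ∀ x y, |g x - g y| ≤ η + K * dist x y := by
  obtain ⟨δ, hδ, h⟩ := Metric.uniformContinuous_iff.1
    (CompactSpace.uniformContinuous_of_continuous g.continuous) η hη
  refine ⟨2 * ‖g‖ / δ, by positivity, fun x y => ?_⟩
  rcases lt_or_ge (dist x y) δ with hxy | hxy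
  · have h1 := (h hxy).le
    rw [Real.dist_eq] at h1
    have : 0 ≤ 2 * ‖g‖ / δ * dist x y := by positivity
    linarith
  · have h1 : |g x - g y| ≤ 2 * ‖g‖ := by
      have h1 := g.norm_coe_le_norm x
      have h2 := g.norm_coe_le_norm y
      rw [Real.norm_eq_abs] at h1 h2
      linarith [abs_sub (g x) (g y)]
    have h2 : 2 * ‖g‖ ≤ 2 * ‖g‖ / δ * dist x y := by
      rw [div_mul_eq_mul_div, le_div_iff₀ hδ]
      exact mul_le_mul_of_nonneg_left hxy (by positivity)
    linarith

/-- If all integrals of continuous functions are Cauchy, then the measures converge. -/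
lemma exists_tendsto_integral_of_cauchySeq {X : Type*} [MetricSpace X] [CompactSpace X]
    [MeasurableSpace X] [BorelSpace X] (μs : ℕ → ProbabilityMeasure X)
    (h : ∀ g : C(X, ℝ), CauchySeq fun n => ∫ x, g x ∂(μs n : Measure X)) :
    ∃ ν : ProbabilityMeasure X, ∀ g : C(X, ℝ),
      Tendsto (fun n => ∫ x, g x ∂(μs n : Measure X)) atTop (nhds (∫ x, g x ∂(ν : Measure X))) := by
  obtain ⟨ν, hν⟩ := exists_clusterPt_of_compactSpace (map μs atTop)
  refine ⟨ν, fun g => ?_⟩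
  obtain ⟨l, hl⟩ := cauchySeq_tendsto_of_complete (h g)
  have hcont : Continuous fun μ : ProbabilityMeasure X => ∫ x, g x ∂(μ : Measure X) := by
    refine continuous_iff_continuousAt.2 fun μ => ?_
    exact (ProbabilityMeasure.tendsto_iff_forall_integral_tendsto.1 tendsto_id)
      (BoundedContinuousFunction.mkOfCompact g)
  have hcl : ClusterPt (∫ x, g x ∂(ν : Measure X)) (nhds l) :=
    (hν.map hcont.continuousAt tendsto_map).mono (by rw [map_map]; exact hl)
  have : ∫ x, g x ∂(ν : Measure X) = l := eq_of_nhds_neBot hcl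
  rwa [this]

lemma isProbabilityMeasure_inv_smul_sum_dirac {X : Type*} [MeasurableSpace X] (T : X → X) (y : X)
    {P : ℕ} (hP : 0 < P) :
    IsProbabilityMeasure
      ((P : ℝ≥0∞)⁻¹ • ∑ ℓ ∈ Finset.range P, Measure.dirac (T^[ℓ] y)) := by
  constructor
  simp only [Measure.smul_apply, Measure.finsetSum_apply, measure_univ, Finset.sum_const,
    Finset.card_range, nsmul_eq_mul, mul_one, smul_eq_mul]
  exact ENNReal.inv_mul_cancel (by exact_mod_cast hP.ne') (ENNReal.natCast_ne_top P)

lemma integral_inv_smul_sum_dirac {X : Type*} [MetricSpace X] [CompactSpace X]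
    [MeasurableSpace X] [BorelSpace X] (T : X → X) (y : X) (P : ℕ) (g : C(X, ℝ)) :
    ∫ x, g x ∂((P : ℝ≥0∞)⁻¹ • ∑ ℓ ∈ Finset.range P, Measure.dirac (T^[ℓ] y)) =
      orbitAvg T y P g := by
  rw [integral_smul_measure, integral_finsetSum_measure]
  · simp [orbitAvg, div_eq_inv_mul]
  · intro i _
    exact g.continuous.integrable_of_hasCompactSupport (HasCompactSupport.of_compactSpace g)

variable {X : Type*} [MetricSpace X] [CompactSpace X]
variable {T : X → X} {ξ : ℕ → X} {π : ℕ → ℕ}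

lemma exists_orbitAvg_warpCost_le (hπ : ∀ n, 0 < π n) (hper : ∀ n, T^[π n] (ξ n) = ξ n)
    (hcauchy : ∀ ε : ℝ, 0 < ε → ∃ n₀ : ℕ, ∀ m ≥ n₀, ∀ n ≥ n₀,
      FKdist dist (fun i => T^[i] (ξ n)) (fun i => T^[i] (ξ m)) < ε) {ε : ℝ} (hε : 0 < ε) :
    ∃ n₀ : ℕ, ∀ m ≥ n₀, ∀ n ≥ n₀, ∀ L : ℕ,
      orbitAvg T (ξ n) (π n) (warpCost T (ξ m) L) ≤ ε * L := by
  obtain ⟨C, hC⟩ : ∃ C : ℝ, ∀ x y : X, dist x y ≤ C := by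
    obtain ⟨C, hC⟩ := Metric.isBounded_iff.1 (isCompact_univ (X := X)).isBounded
    exact ⟨C, fun x y => hC (mem_univ x) (mem_univ y)⟩
  have hC0 : 0 ≤ C := dist_nonneg.trans (hC (ξ 0) (ξ 0))
  obtain ⟨n₀, h⟩ := hcauchy (ε / (3 + C)) (by positivity)
  refine ⟨n₀, fun m hm n hn L => ?_⟩
  have := orbitAvg_warpCost_le hC (hπ n) (hper n) (h m hm n hn) L
  rwa [mul_div_cancel₀ _ (by positivity)] at this

/-- Periodic averages of a continuous function are Cauchy. -/
lemma cauchySeq_orbitAvg (hπ : ∀ n, 0 < π n) (hper : ∀ n, T^[π n] (ξ n) = ξ n)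
    (hcauchy : ∀ ε : ℝ, 0 < ε → ∃ n₀ : ℕ, ∀ m ≥ n₀, ∀ n ≥ n₀,
      FKdist dist (fun i => T^[i] (ξ n)) (fun i => T^[i] (ξ m)) < ε) (g : C(X, ℝ)) :
    CauchySeq fun n => orbitAvg T (ξ n) (π n) g := by
  have hM : ∀ x, |g x| ≤ ‖g‖ := g.norm_coe_le_norm
  rw [Metric.cauchySeq_iff]
  intro ζ hζ
  obtain ⟨K, hK, hg⟩ := exists_abs_sub_le_add_mul_dist g (η := ζ / 4) (by positivity)
  obtain ⟨n₀, h⟩ := exists_orbitAvg_warpCost_le hπ hper hcauchy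
    (ε := ζ / 4 / (K + 2 * ‖g‖ + 1)) (by positivity)
  refine ⟨n₀, fun n hn m hm => ?_⟩
  have hP' : (0 : ℝ) < π n := by exact_mod_cast hπ n
  have hbound : ∀ L : ℕ, 0 < L → |orbitAvg T (ξ n) (π n) g - orbitAvg T (ξ m) (π m) g| ≤
      ζ / 2 + 4 * π m * ‖g‖ / L := by
    intro L hL
    have hL' : (0 : ℝ) < L := by exact_mod_cast hL
    set c := orbitAvg T (ξ m) (π m) g with hc
    set a := orbitAvg T (ξ n) (π n) g with ha
    have h1 : ∑ j ∈ Finset.range (π n), (∑ i ∈ Finset.range L, g (T^[i] (T^[j] (ξ n))) - L * c) =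
        π n * (L * (a - c)) := by
      rw [Finset.sum_sub_distrib, Finset.sum_comm]
      have : ∀ i ∈ Finset.range L, ∑ j ∈ Finset.range (π n), g (T^[i] (T^[j] (ξ n))) =
          π n * a := by
        intro i _
        have hshift : ∀ i : ℕ, orbitAvg T (ξ n) (π n) (fun x => g (T^[i] x)) = a := by
          intro i
          induction i with
          | zero => simp [ha]
          | succ i ih =>
            rw [← ih]
            exact orbitAvg_shift (hper n) (fun x => g (T^[i] x))
        rw [← hshift i, orbitAvg]
        field_simp
      rw [Finset.sum_congr rfl this]
      simp
      ring
    have h2 : π n * (L * |a - c|) ≤ ∑ j ∈ Finset.range (π n), (ζ / 4 * L +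
        (K + 2 * ‖g‖) * warpCost T (ξ m) L (T^[j] (ξ n)) + 4 * π m * ‖g‖) := by
      have habs : π n * (L * |a - c|) = |π n * (L * (a - c))| := by
        rw [abs_mul, abs_mul, abs_of_pos hP', abs_of_pos hL']
      rw [habs, ← h1]
      exact (Finset.abs_sum_le_sum_abs _ _).trans (Finset.sum_le_sum fun j _ =>
        abs_sum_range_sub_le_warpCost hM hK hg (hπ m) (hper m) L _)
    have h3 := h m hm n hn L
    rw [orbitAvg, div_le_iff₀ hP'] at h3
    rw [Finset.sum_add_distrib, Finset.sum_add_distrib, ← Finset.mul_sum] at h2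
    simp only [Finset.sum_const, Finset.card_range, nsmul_eq_mul] at h2
    have h4 : (K + 2 * ‖g‖) * ∑ j ∈ Finset.range (π n), warpCost T (ξ m) L (T^[j] (ξ n)) ≤
        ζ / 4 * L * π n := by
      refine (mul_le_mul_of_nonneg_left h3 (by positivity)).trans ?_
      have : (K + 2 * ‖g‖) * (ζ / 4 / (K + 2 * ‖g‖ + 1)) ≤ ζ / 4 := by
        rw [mul_div_assoc', div_le_iff₀ (by positivity)]
        nlinarith
      calc (K + 2 * ‖g‖) * (ζ / 4 / (K + 2 * ‖g‖ + 1) * L * π n)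
          = (K + 2 * ‖g‖) * (ζ / 4 / (K + 2 * ‖g‖ + 1)) * (L * π n) := by ring
        _ ≤ ζ / 4 * (L * π n) := mul_le_mul_of_nonneg_right this (by positivity)
        _ = _ := by ring
    have h5 : L * |a - c| ≤ ζ / 2 * L + 4 * π m * ‖g‖ := by
      rw [Finset.mul_sum] at h4
      refine le_of_mul_le_mul_left (h2.trans ?_) hP'
      linarith
    rw [mul_comm, ← le_div_iff₀ hL'] at h5
    refine h5.trans (le_of_eq ?_)
    field_simp
  have hle : |orbitAvg T (ξ n) (π n) g - orbitAvg T (ξ m) (π m) g| ≤ ζ / 2 := by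
    have ht : Tendsto (fun L : ℕ => ζ / 2 + 4 * π m * ‖g‖ / (L : ℝ)) atTop
        (nhds (ζ / 2 + 0)) :=
      tendsto_const_nhds.add (tendsto_const_div_atTop_nhds_zero_nat _)
    rw [add_zero] at ht
    refine ge_of_tendsto ht ?_
    filter_upwards [eventually_gt_atTop 0] with L hL using hbound L hL
  rw [Real.dist_eq]
  linarith

end Limit

/-! ### Measures shadowed by periodic orbits -/

/-- The measure `ν` is shadowed by periodic orbits: for every `ε` there is a periodic orbit along
which `ν`-typical orbits can be traced with average cost at most `ε` per unit of time. -/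
def ShadowedByPeriodic {X : Type*} [Dist X] [MeasurableSpace X] (T : X → X) (ν : Measure X) :
    Prop :=
  ∀ ε : ℝ, 0 < ε → ∃ (y : X) (P : ℕ), 0 < P ∧ T^[P] y = y ∧
    ∀ L : ℕ, ∫ x, warpCost T y L x ∂ν ≤ ε * L

section Invariant

variable {X : Type*} [MeasurableSpace X] {T : X → X} {ν : Measure X}

lemma integral_sum_range_iterate (hT : MeasurePreserving T ν ν) {g : X → ℝ}
    (hg : Integrable g ν) (L : ℕ) :
    Integrable (fun x => ∑ i ∈ Finset.range L, g (T^[i] x)) ν ∧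
      ∫ x, ∑ i ∈ Finset.range L, g (T^[i] x) ∂ν = L * ∫ x, g x ∂ν := by
  have hi : ∀ i : ℕ, Integrable (fun x => g (T^[i] x)) ν := fun i =>
    (hT.iterate i).integrable_comp_of_integrable hg
  refine ⟨integrable_finsetSum _ fun i _ => hi i, ?_⟩
  rw [integral_finsetSum _ fun i _ => hi i]
  have : ∀ i : ℕ, ∫ x, g (T^[i] x) ∂ν = ∫ x, g x ∂ν := fun i => by
    have h := (hT.iterate i).map_eq
    conv_rhs => rw [← h]
    rw [integral_map (hT.iterate i).measurable.aemeasurable]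
    rw [h]; exact hg.aestronglyMeasurable
  simp [this]

end Invariant

section Ergodicity

variable {X : Type*} [MetricSpace X] [CompactSpace X] [MeasurableSpace X] [BorelSpace X]
  {T : X → X} {ν : Measure X} [IsProbabilityMeasure ν]

lemma integrable_warpCost (hT : Continuous T) (y : X) (L : ℕ) :
    Integrable (warpCost T y L) ν :=
  (continuous_warpCost hT y L).integrable_of_hasCompactSupport (HasCompactSupport.of_compactSpace _)

/-- An invariant set is `L¹`-close to a constant. -/
lemma ShadowedByPeriodic.exists_integral_abs_indicator_sub_le (hT : Continuous T)
    (hinv : MeasurePreserving T ν ν) (h : ShadowedByPeriodic T ν) {s : Set X}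
    (hs : MeasurableSet s) (hTs : T ⁻¹' s = s) {ζ : ℝ} (hζ : 0 < ζ) :
    ∃ c : ℝ, ∫ x, |s.indicator 1 x - c| ∂ν ≤ ζ := by
  have hindi : Integrable (s.indicator (1 : X → ℝ)) ν :=
    (integrable_const (1 : ℝ)).indicator hs
  obtain ⟨g₀, hg₀, hg₀i⟩ := hindi.exists_boundedContinuous_integral_sub_le
    (ε := ζ / 4) (by positivity)
  set g : C(X, ℝ) := g₀.toContinuousMap with hgdef
  have hgint : ∫ x, |s.indicator 1 x - g x| ∂ν ≤ ζ / 4 := hg₀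
  have hgi : Integrable g ν := hg₀i
  have hM : ∀ x, |g x| ≤ ‖g‖ := g.norm_coe_le_norm
  obtain ⟨K, hK, hg⟩ := exists_abs_sub_le_add_mul_dist g (η := ζ / 4) (by positivity)
  obtain ⟨y, P, hP, hy, hcost⟩ := h (ζ / 4 / (K + 2 * ‖g‖ + 1)) (by positivity)
  obtain ⟨L, hL⟩ := exists_nat_gt (4 * P * ‖g‖ / (ζ / 4))
  have hL0 : (0 : ℝ) < L := lt_of_le_of_lt (by positivity) hL
  rw [div_lt_iff₀ (by positivity)] at hL
  set c := orbitAvg T y P g with hc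
  refine ⟨c, ?_⟩
  have hiter : ∀ i x, s.indicator (1 : X → ℝ) (T^[i] x) = s.indicator 1 x := by
    intro i x
    have : x ∈ s ↔ T^[i] x ∈ s := by
      induction i with
      | zero => simp
      | succ i ih =>
        rw [Function.iterate_succ_apply', ih]
        exact ⟨fun h => by rw [← hTs] at h; exact h, fun h => by rw [← hTs]; exact h⟩
    by_cases hx : x ∈ s
    · rw [indicator_of_mem hx, indicator_of_mem (this.1 hx)]; rfl
    · rw [indicator_of_notMem hx, indicator_of_notMem (fun h => hx (this.2 h))]
  have hpt : ∀ x, L * |s.indicator 1 x - c| ≤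
      (∑ i ∈ Finset.range L, |s.indicator 1 (T^[i] x) - g (T^[i] x)|) +
        (ζ / 4 * L + (K + 2 * ‖g‖) * warpCost T y L x + 4 * P * ‖g‖) := by
    intro x
    have h1 : L * |s.indicator 1 x - c| =
        |∑ i ∈ Finset.range L, (s.indicator 1 (T^[i] x) - g (T^[i] x)) +
          (∑ i ∈ Finset.range L, g (T^[i] x) - L * c)| := by
      rw [Finset.sum_sub_distrib, sub_add_sub_cancel]
      simp only [hiter]
      simp only [Finset.sum_const, Finset.card_range, nsmul_eq_mul]
      rw [← mul_sub, abs_mul, abs_of_pos hL0]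
    rw [h1]
    refine (abs_add_le _ _).trans (add_le_add (Finset.abs_sum_le_sum_abs _ _) ?_)
    exact abs_sum_range_sub_le_warpCost hM hK hg hP hy L x
  have hdi : Integrable (fun x => |s.indicator 1 x - g x|) ν := (hindi.sub hgi).abs
  obtain ⟨hsi, hsum⟩ := integral_sum_range_iterate hinv hdi L
  have hwi : Integrable (fun x => (K + 2 * ‖g‖) * warpCost T y L x) ν :=
    (integrable_warpCost hT y L).const_mul _
  have h2i : Integrable (fun x => ζ / 4 * L + (K + 2 * ‖g‖) * warpCost T y L x) ν :=
    (integrable_const _).add hwi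
  have h3i : Integrable
      (fun x => ζ / 4 * L + (K + 2 * ‖g‖) * warpCost T y L x + 4 * P * ‖g‖) ν :=
    h2i.add (integrable_const _)
  have hle := integral_mono (((hindi.sub (integrable_const c)).abs).const_mul (L : ℝ))
    (hsi.add h3i) hpt
  rw [integral_const_mul] at hle
  have heq : ∫ x, ((∑ i ∈ Finset.range L, |s.indicator 1 (T^[i] x) - g (T^[i] x)|) +
        (ζ / 4 * L + (K + 2 * ‖g‖) * warpCost T y L x + 4 * P * ‖g‖)) ∂ν =
      L * ∫ x, |s.indicator 1 x - g x| ∂ν +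
        (ζ / 4 * L + (K + 2 * ‖g‖) * ∫ x, warpCost T y L x ∂ν + 4 * P * ‖g‖) := by
    rw [integral_add hsi h3i, hsum, integral_add h2i (integrable_const _),
      integral_add (integrable_const _) hwi, integral_const_mul]
    simp [integral_const_mul]
  have h4 : (K + 2 * ‖g‖) * ∫ x, warpCost T y L x ∂ν ≤ ζ / 4 * L := by
    refine (mul_le_mul_of_nonneg_left (hcost L) (by positivity)).trans ?_
    rw [← mul_assoc]
    refine mul_le_mul_of_nonneg_right ?_ hL0.le
    rw [mul_div_assoc', div_le_iff₀ (by positivity)]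
    nlinarith
  have h5 : L * ∫ x, |s.indicator 1 x - g x| ∂ν ≤ L * (ζ / 4) :=
    mul_le_mul_of_nonneg_left hgint hL0.le
  refine le_of_mul_le_mul_left ((hle.trans heq.le).trans ?_) hL0
  linarith

lemma ShadowedByPeriodic.ergodic (hT : Continuous T)
    (hinv : MeasurePreserving T ν ν) (h : ShadowedByPeriodic T ν) : Ergodic T ν := by
  refine ⟨hinv, ⟨fun s hs hTs => ?_⟩⟩
  have key : ν.real s * (1 - ν.real s) ≤ 0 := by
    refine le_of_forall_pos_le_add fun ζ hζ => ?_
    obtain ⟨c, hc⟩ := h.exists_integral_abs_indicator_sub_le hT hinv hs hTs hζ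
    have hval : ∫ x, |s.indicator 1 x - c| ∂ν =
        ν.real s * |1 - c| + (1 - ν.real s) * |c| := by
      have : (fun x => |s.indicator (1 : X → ℝ) x - c|) =
          fun x => s.indicator (fun _ => |1 - c|) x + sᶜ.indicator (fun _ => |c|) x := by
        ext x
        by_cases hx : x ∈ s <;> simp [hx]
      rw [this, integral_add ((integrable_const _).indicator hs)
        ((integrable_const _).indicator hs.compl), integral_indicator_const _ hs,
        integral_indicator_const _ hs.compl, probReal_compl_eq_one_sub hs]
      simp
    rw [hval] at hc
    have h0 : 0 ≤ ν.real s := measureReal_nonneg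
    have h1 : ν.real s ≤ 1 := measureReal_le_one
    have h2 : 1 ≤ |1 - c| + |c| := by
      have := abs_add_le (1 - c) c
      simpa using this
    have h3 := mul_nonneg h0 (sub_nonneg.2 h1)
    nlinarith [mul_nonneg (mul_nonneg h0 h0) (abs_nonneg (1 - c)),
      mul_nonneg (mul_nonneg (sub_nonneg.2 h1) (sub_nonneg.2 h1)) (abs_nonneg c),
      mul_le_mul_of_nonneg_left h2 h3]
  have h0 : 0 ≤ ν.real s := measureReal_nonneg
  have h1 : ν.real s ≤ 1 := measureReal_le_one
  rw [eventuallyConst_set']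
  have : ν.real s = 0 ∨ ν.real s = 1 := by
    rcases mul_eq_zero.1 (le_antisymm key (mul_nonneg h0 (sub_nonneg.2 h1))) with h | h
    · exact Or.inl h
    · exact Or.inr (by linarith)
  rcases this with h | h
  · left
    rw [measureReal_eq_zero_iff] at h
    exact ae_eq_empty.2 h
  · right
    have hc : ν.real sᶜ = 0 := by rw [probReal_compl_eq_one_sub hs, h, sub_self]
    rw [measureReal_eq_zero_iff] at hc
    exact ae_eq_univ.2 hc

end Ergodicity

/-! ### Entropy -/

/-- The **Gibbs inequality** for a weight `q` of total mass at most `Z`. -/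
lemma sum_negMulLog_le {ι : Type*} [Fintype ι] {p q : ι → ℝ} (hp : ∀ i, 0 ≤ p i)
    (hp1 : ∑ i, p i = 1) (hq : ∀ i, 0 < q i) {Z : ℝ} (hZ : 0 < Z) (hqZ : ∑ i, q i ≤ Z) :
    ∑ i, Real.negMulLog (p i) ≤ ∑ i, p i * (-Real.log (q i)) + Real.log Z := by
  have hterm : ∀ i, Real.negMulLog (p i) ≤
      p i * (-Real.log (q i)) + p i * Real.log Z + (q i / Z - p i) := by
    intro i
    rcases (hp i).eq_or_lt with h | h
    · rw [← h]
      have := div_pos (hq i) hZ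
      simpa using this.le
    · have h1 := Real.log_le_sub_one_of_pos (div_pos (div_pos (hq i) hZ) h)
      rw [Real.log_div (div_pos (hq i) hZ).ne' h.ne', Real.log_div (hq i).ne' hZ.ne'] at h1
      have h2 := mul_le_mul_of_nonneg_left h1 h.le
      have h3 : p i * (q i / Z / p i - 1) = q i / Z - p i := by field_simp
      rw [h3] at h2
      unfold Real.negMulLog
      linarith
  refine (Finset.sum_le_sum fun i _ => hterm i).trans ?_
  rw [Finset.sum_add_distrib, Finset.sum_add_distrib, Finset.sum_sub_distrib, hp1,
    ← Finset.sum_mul, hp1, ← Finset.sum_div]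
  have : (∑ i, q i) / Z ≤ 1 := (div_le_one hZ).2 hqZ
  linarith

section EditCost

variable {X : Type*} {m : ℕ}

/-- The number of edits needed to obtain the word `s` from the `W`-colors of the orbit of `y`
along the time change `φ`. -/
def pathEditCost (T : X → X) (W : X → Fin m) (y : X) {L : ℕ} (s : Fin L → Fin m) (φ : ℕ → ℕ) : ℕ :=
  ∑ i : Fin L, (((φ (i + 1) : ℤ) - φ i - 1).natAbs + if s i = W (T^[φ i] y) then 0 else 1)

/-- The least number of edits needed to obtain the word `s` from the `W`-colors of the orbit
of `y` along a monotone time change. -/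
def editCost (T : X → X) (W : X → Fin m) (y : X) {L : ℕ} (s : Fin L → Fin m) : ℕ :=
  ⨅ φ : {φ : ℕ → ℕ // Monotone φ}, pathEditCost T W y s φ.1

/-- The total weight of all ways of obtaining the word `s` by editing the `W`-colors of the orbit
starting at `z`, each edit having weight `t`. -/
def editWeight (T : X → X) (W : X → Fin m) (t : ℝ≥0∞) :
    (L : ℕ) → X → (Fin L → Fin m) → ℝ≥0∞
  | 0, _, _ => 1
  | L + 1, z, s => ∑' k : ℕ, t ^ ((k : ℤ) - 1).natAbs * (if s 0 = W z then 1 else t) *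
      editWeight T W t L (T^[k] z) (Fin.tail s)

lemma tsum_pow_natAbs_sub_one (t : ℝ≥0∞) :
    ∑' k : ℕ, t ^ ((k : ℤ) - 1).natAbs = t + (1 - t)⁻¹ := by
  rw [tsum_eq_zero_add' ENNReal.summable, ← ENNReal.tsum_geometric]
  simp

lemma sum_editWeight_le (T : X → X) (W : X → Fin m) (t : ℝ≥0∞) (L : ℕ) (z : X) :
    ∑ s, editWeight T W t L z s ≤ ((t + (1 - t)⁻¹) * (1 + m * t)) ^ L := by
  induction L generalizing z with
  | zero => simp [editWeight]
  | succ L ih =>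
    rw [← (Fin.consEquiv fun _ : Fin (L + 1) => Fin m).sum_comp, Fintype.sum_prod_type]
    simp only [Fin.consEquiv_apply, editWeight, Fin.cons_zero]
    simp only [← Summable.tsum_finsetSum (fun _ _ => ENNReal.summable)]
    have hcol : ∑ a : Fin m, (if a = W z then 1 else t) ≤ 1 + m * t := by
      calc ∑ a : Fin m, (if a = W z then 1 else t)
          ≤ ∑ a : Fin m, ((if a = W z then 1 else 0) + t) := by
            refine Finset.sum_le_sum fun a _ => ?_
            split_ifs <;> simp
        _ = 1 + m * t := by
            rw [Finset.sum_add_distrib, Finset.sum_ite_eq' Finset.univ (W z)]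
            simp
    calc ∑' k : ℕ, ∑ a : Fin m, ∑ s : Fin L → Fin m,
          t ^ ((k : ℤ) - 1).natAbs * (if a = W z then 1 else t) * editWeight T W t L (T^[k] z) s
        = ∑' k : ℕ, t ^ ((k : ℤ) - 1).natAbs * ((∑ a : Fin m, (if a = W z then 1 else t)) *
            ∑ s : Fin L → Fin m, editWeight T W t L (T^[k] z) s) := by
          refine tsum_congr fun k => ?_
          simp only [← Finset.mul_sum, ← Finset.sum_mul, mul_assoc]
      _ ≤ ∑' k : ℕ, t ^ ((k : ℤ) - 1).natAbs * ((1 + m * t) *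
            ((t + (1 - t)⁻¹) * (1 + m * t)) ^ L) := by
          refine ENNReal.tsum_le_tsum fun k => ?_
          gcongr
          exact ih _
      _ = _ := by
          rw [ENNReal.tsum_mul_right, tsum_pow_natAbs_sub_one]
          ring

lemma pow_pathEditCost_le (T : X → X) (W : X → Fin m) (t : ℝ≥0∞) (y : X) {L : ℕ}
    (s : Fin L → Fin m) {φ : ℕ → ℕ} (hφ : Monotone φ) :
    t ^ pathEditCost T W y s φ ≤ editWeight T W t L (T^[φ 0] y) s := by
  induction L generalizing φ with
  | zero => simp [pathEditCost, editWeight]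
  | succ L ih =>
    have hsucc : pathEditCost T W y s φ =
        (((φ 1 : ℤ) - φ 0 - 1).natAbs + if s 0 = W (T^[φ 0] y) then 0 else 1) +
          pathEditCost T W y (Fin.tail s) (fun i => φ (i + 1)) := by
      unfold pathEditCost
      rw [Fin.sum_univ_succ]
      simp [Fin.tail]
      rfl
    have h1 := ih (Fin.tail s) (φ := fun i => φ (i + 1)) (fun a b hab => hφ (by omega))
    obtain ⟨k, hk⟩ := Nat.exists_eq_add_of_le (hφ zero_le_one)
    refine le_trans ?_ (ENNReal.le_tsum k)
    rw [hsucc, pow_add, pow_add]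
    refine mul_le_mul' (mul_le_mul' (le_of_eq ?_) ?_) ?_
    · rw [hk]; push_cast; congr 2; ring
    · split_ifs <;> simp
    · rw [← Function.iterate_add_apply, add_comm k, ← hk]
      simpa using h1

lemma editCost_le (T : X → X) (W : X → Fin m) (y : X) {L : ℕ} (s : Fin L → Fin m)
    {φ : ℕ → ℕ} (hφ : Monotone φ) : editCost T W y s ≤ pathEditCost T W y s φ :=
  ciInf_le (f := fun φ : {φ : ℕ → ℕ // Monotone φ} => pathEditCost T W y s φ.1)
    (OrderBot.bddBelow _) ⟨φ, hφ⟩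

lemma sum_pow_editCost_le (T : X → X) (W : X → Fin m) {t : ℝ} (ht0 : 0 < t) (ht1 : t < 1)
    {y : X} {P : ℕ} (hP : 0 < P) (hy : T^[P] y = y) (L : ℕ) :
    ∑ s : Fin L → Fin m, t ^ editCost T W y s ≤ P * ((t + (1 - t)⁻¹) * (1 + m * t)) ^ L := by
  have h1t : 0 < 1 - t := by linarith
  have hENN : ∑ s : Fin L → Fin m, ENNReal.ofReal t ^ editCost T W y s ≤
      P * ((ENNReal.ofReal t + (1 - ENNReal.ofReal t)⁻¹) * (1 + m * ENNReal.ofReal t)) ^ L := by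
    calc ∑ s : Fin L → Fin m, ENNReal.ofReal t ^ editCost T W y s
        ≤ ∑ s : Fin L → Fin m, ∑ j ∈ Finset.range P,
            editWeight T W (ENNReal.ofReal t) L (T^[j] y) s := by
          refine Finset.sum_le_sum fun s _ => ?_
          obtain ⟨φ, hφ⟩ := ciInf_mem fun φ : {φ : ℕ → ℕ // Monotone φ} =>
            pathEditCost T W y s φ.1
          have h := pow_pathEditCost_le T W (ENNReal.ofReal t) y s φ.2
          rw [show pathEditCost T W y s φ.1 = editCost T W y s from hφ] at h
          refine h.trans ?_
          have hmod : T^[φ.1 0] y = T^[φ.1 0 % P] y := by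
            have hper : Function.Periodic (fun n => T^[n] y) P := fun n => by
              change T^[n + P] y = T^[n] y
              rw [Function.iterate_add_apply, hy]
            exact (hper.map_mod_nat (φ.1 0)).symm
          rw [hmod]
          exact Finset.single_le_sum (f := fun j =>
            editWeight T W (ENNReal.ofReal t) L (T^[j] y) s) (fun _ _ => zero_le)
            (Finset.mem_range.2 (Nat.mod_lt _ hP))
      _ ≤ ∑ j ∈ Finset.range P, ((ENNReal.ofReal t + (1 - ENNReal.ofReal t)⁻¹) *
            (1 + m * ENNReal.ofReal t)) ^ L := by
          rw [Finset.sum_comm]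
          exact Finset.sum_le_sum fun j _ => sum_editWeight_le T W _ L _
      _ = _ := by simp
  have hR : (P : ℝ≥0∞) * ((ENNReal.ofReal t + (1 - ENNReal.ofReal t)⁻¹) *
      (1 + m * ENNReal.ofReal t)) ^ L =
      ENNReal.ofReal (P * ((t + (1 - t)⁻¹) * (1 + m * t)) ^ L) := by
    rw [ENNReal.ofReal_mul (by positivity), ENNReal.ofReal_natCast,
      ENNReal.ofReal_pow (by positivity), ENNReal.ofReal_mul (by positivity),
      ENNReal.ofReal_add ht0.le (by positivity), ENNReal.ofReal_inv_of_pos h1t,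
      ENNReal.ofReal_sub _ ht0.le, ENNReal.ofReal_add zero_le_one (by positivity),
      ENNReal.ofReal_mul (by positivity), ENNReal.ofReal_natCast, ENNReal.ofReal_one]
  have hL : ∑ s : Fin L → Fin m, ENNReal.ofReal t ^ editCost T W y s =
      ENNReal.ofReal (∑ s : Fin L → Fin m, t ^ editCost T W y s) := by
    rw [ENNReal.ofReal_sum_of_nonneg fun _ _ => by positivity]
    exact Finset.sum_congr rfl fun _ _ => (ENNReal.ofReal_pow ht0.le _).symm
  rw [hR, hL] at hENN
  exact (ENNReal.ofReal_le_ofReal_iff (by positivity)).1 hENN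

end EditCost

/-- The number of edits of the itinerary of `x` is controlled by the shadowing cost, when the
colors are approximated by the function `f` and `W` is the color nearest to `f`. -/
lemma editCost_itinerary_le {X : Type*} [MetricSpace X] {T : X → X} {m : ℕ} {c W : X → Fin m}
    {f : X → ℝ} {η K : ℝ} (hK : 0 ≤ K) (hf : ∀ x y, |f x - f y| ≤ η + K * dist x y)
    (hW : ∀ z (a : Fin m), |((W z : ℕ) : ℝ) - f z| ≤ |((a : ℕ) : ℝ) - f z|) (y x : X) (L : ℕ) :
    (editCost T W y (fun i : Fin L => c (T^[i] x)) : ℝ) ≤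
      (∑ i ∈ Finset.range L, 2 * |((c (T^[i] x) : ℕ) : ℝ) - f (T^[i] x)|) + 2 * η * L +
        (2 * K + 1) * warpCost T y L x := by
  have hη : 0 ≤ η := by simpa using hf y y
  have hpos : 0 < 2 * K + 1 := by linarith
  rw [← sub_le_iff_le_add', ← div_le_iff₀' hpos]
  refine le_ciInf fun φ => ?_
  rw [div_le_iff₀' hpos, sub_le_iff_le_add']
  refine (Nat.cast_le.2 (editCost_le T W y _ φ.2)).trans ?_
  unfold pathEditCost
  rw [Fin.sum_univ_eq_sum_range (fun i => ((φ.1 (i + 1) : ℤ) - φ.1 i - 1).natAbs +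
    if c (T^[i] x) = W (T^[φ.1 i] y) then 0 else 1) L]
  have hηL : 2 * η * L = ∑ i ∈ Finset.range L, 2 * η := by simp; ring
  rw [hηL, Finset.mul_sum, ← Finset.sum_add_distrib, ← Finset.sum_add_distrib]
  push_cast [Nat.cast_natAbs]
  refine Finset.sum_le_sum fun i _ => ?_
  unfold stepCost
  have hJ : 0 ≤ |(φ.1 (i + 1) : ℝ) - φ.1 i - 1| := abs_nonneg _
  have hd : 0 ≤ dist (T^[i] x) (T^[φ.1 i] y) := dist_nonneg
  have hKd := mul_nonneg hK hd
  have hKJ := mul_nonneg hK hJ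
  have hc0 := abs_nonneg (((c (T^[i] x) : ℕ) : ℝ) - f (T^[i] x))
  split_ifs with h
  · nlinarith
  · have h1 : 1 ≤ |((c (T^[i] x) : ℕ) : ℝ) - ((W (T^[φ.1 i] y) : ℕ) : ℝ)| := by
      have hne : ((c (T^[i] x) : ℕ) : ℤ) - ((W (T^[φ.1 i] y) : ℕ) : ℤ) ≠ 0 := by
        intro h0
        exact h (Fin.ext (by omega))
      exact_mod_cast Int.one_le_abs hne
    have h2 := hW (T^[φ.1 i] y) (c (T^[i] x))
    have h3 := hf (T^[i] x) (T^[φ.1 i] y)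
    have h4 := abs_sub_le ((c (T^[i] x) : ℕ) : ℝ) (f (T^[φ.1 i] y)) ((W (T^[φ.1 i] y) : ℕ) : ℝ)
    have h5 := abs_sub_le ((c (T^[i] x) : ℕ) : ℝ) (f (T^[i] x)) (f (T^[φ.1 i] y))
    rw [abs_sub_comm (f (T^[φ.1 i] y))] at h4
    nlinarith

/-- Expectations over itineraries. -/
lemma sum_measure_itinerary_mul {X : Type*} [MetricSpace X] [MeasurableSpace X] [BorelSpace X]
    {T : X → X} {ν : Measure X} [IsProbabilityMeasure ν] (hT : Continuous T) {m : ℕ} {c : X → Fin m} (hc : Measurable c)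
    (L : ℕ) (e : (Fin L → Fin m) → ℝ) :
    ∑ s : Fin L → Fin m, (ν {x | ∀ i : Fin L, c (T^[(i : ℕ)] x) = s i}).toReal * e s =
      ∫ x, e (fun i : Fin L => c (T^[(i : ℕ)] x)) ∂ν := by
  set itin : X → (Fin L → Fin m) := fun x i => c (T^[(i : ℕ)] x) with hitin
  have hm : Measurable itin :=
    measurable_pi_lambda _ fun i => hc.comp (hT.iterate i).measurable
  have : IsProbabilityMeasure (ν.map itin) := Measure.isProbabilityMeasure_map hm.aemeasurable
  have he : Measurable e := measurable_of_finite e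
  rw [← integral_map hm.aemeasurable he.aestronglyMeasurable (f := e),
    integral_fintype Integrable.of_finite]
  refine Finset.sum_congr rfl fun s _ => ?_
  rw [smul_eq_mul, Measure.real, Measure.map_apply hm (measurableSet_singleton s)]
  congr 3
  ext x
  simp [hitin, funext_iff]

section ZeroEntropy

variable {X : Type*} [MetricSpace X] [CompactSpace X] [MeasurableSpace X] [BorelSpace X]
  {T : X → X} {ν : Measure X} [IsProbabilityMeasure ν]

lemma ShadowedByPeriodic.exists_sum_negMulLog_le (hT : Continuous T)
    (hinv : MeasurePreserving T ν ν) (h : ShadowedByPeriodic T ν) {m : ℕ} {c : X → Fin m}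
    (hc : Measurable c) {ζ : ℝ} (hζ : 0 < ζ) :
    ∃ n : ℕ, (∑ s : Fin (n + 1) → Fin m,
        Real.negMulLog ((ν {x | ∀ i : Fin (n + 1), c (T^[(i : ℕ)] x) = s i}).toReal))
        / ((n : ℝ) + 1) ≤ ζ := by
  obtain ⟨t, ht0, ht1, hlog⟩ : ∃ t : ℝ, 0 < t ∧ t < 1 ∧
      Real.log ((t + (1 - t)⁻¹) * (1 + m * t)) < ζ / 8 := by
    have hcont : ContinuousAt (fun t : ℝ => Real.log ((t + (1 - t)⁻¹) * (1 + m * t))) 0 := by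
      refine ContinuousAt.log ?_ (by simp)
      refine ContinuousAt.mul (continuousAt_id.add (ContinuousAt.inv₀ ?_ (by simp))) ?_
      · fun_prop
      · fun_prop
    have hev := hcont.eventually_lt (continuousAt_const (y := ζ / 8)) (by simpa using hζ)
    obtain ⟨t, ht, ht'⟩ := ((hev.filter_mono nhdsWithin_le_nhds).and
      (Ioo_mem_nhdsGT (zero_lt_one (α := ℝ)))).exists
    exact ⟨t, ht'.1, ht'.2, ht⟩
  set κ := -Real.log t with hκ
  have hκ0 : 0 < κ := by linarith [Real.log_neg ht0 ht1]
  set ρ := ζ / (8 * κ) with hρ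
  have hρ0 : 0 < ρ := by positivity
  have hcR : Measurable fun x => ((c x : ℕ) : ℝ) :=
    (measurable_of_finite fun a : Fin m => ((a : ℕ) : ℝ)).comp hc
  have hci : Integrable (fun x => ((c x : ℕ) : ℝ)) ν := by
    refine Integrable.of_bound hcR.aestronglyMeasurable m (Eventually.of_forall fun x => ?_)
    simp
  obtain ⟨f₀, hf₀, hf₀i⟩ := hci.exists_boundedContinuous_integral_sub_le hρ0
  set f : C(X, ℝ) := f₀.toContinuousMap with hfdef
  have hfint : ∫ x, |((c x : ℕ) : ℝ) - f x| ∂ν ≤ ρ := hf₀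
  have hfi : Integrable f ν := hf₀i
  obtain ⟨K, hK, hf⟩ := exists_abs_sub_le_add_mul_dist f hρ0
  obtain ⟨y, P, hP, hy, hcost⟩ := h (ρ / (2 * K + 1)) (by positivity)
  have hP' : (0 : ℝ) < P := by exact_mod_cast hP
  have : Nonempty (Fin m) := ⟨c y⟩
  choose W hW using fun z : X => Finite.exists_min fun a : Fin m => |((a : ℕ) : ℝ) - f z|
  obtain ⟨n, hn⟩ := exists_nat_gt (Real.log P / (ζ / 8))
  refine ⟨n, ?_⟩
  rw [div_lt_iff₀ (by positivity)] at hn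
  set L := n + 1 with hL
  have hLn : (n : ℝ) + 1 = L := by rw [hL]; push_cast; ring
  have hL0 : (0 : ℝ) < L := by rw [← hLn]; positivity
  rw [hLn, div_le_iff₀ hL0]
  have hgibbs := sum_negMulLog_le
    (p := fun s : Fin L → Fin m => (ν {x | ∀ i : Fin L, c (T^[(i : ℕ)] x) = s i}).toReal)
    (q := fun s => t ^ editCost T W y s)
    (fun _ => ENNReal.toReal_nonneg)
    (by simpa using sum_measure_itinerary_mul (ν := ν) hT hc L (fun _ => 1))
    (fun _ => by positivity)
    (by have : 0 < 1 - t := by linarith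
        positivity) (sum_pow_editCost_le T W ht0 ht1 hP hy L)
  refine hgibbs.trans ?_
  rw [sum_measure_itinerary_mul hT hc L (fun s => -Real.log (t ^ editCost T W y s))]
  have h1t : 0 < 1 - t := by linarith
  rw [Real.log_mul hP'.ne' (by positivity), Real.log_pow]
  simp only [Real.log_pow, ← mul_neg, ← hκ]
  rw [integral_mul_const]
  have hdi : Integrable (fun x => 2 * |((c x : ℕ) : ℝ) - f x|) ν := ((hci.sub hfi).abs).const_mul 2
  obtain ⟨hsi, hsum⟩ := integral_sum_range_iterate hinv hdi L
  have hwi : Integrable (fun x => (2 * K + 1) * warpCost T y L x) ν :=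
    (integrable_warpCost hT y L).const_mul _
  have h2i : Integrable (fun x => (∑ i ∈ Finset.range L,
      2 * |((c (T^[i] x) : ℕ) : ℝ) - f (T^[i] x)|) + 2 * ρ * L) ν := hsi.add (integrable_const _)
  have hle : ∫ x, (editCost T W y (fun i : Fin L => c (T^[(i : ℕ)] x)) : ℝ) ∂ν ≤ 5 * ρ * L := by
    calc ∫ x, (editCost T W y (fun i : Fin L => c (T^[(i : ℕ)] x)) : ℝ) ∂ν
        ≤ ∫ x, ((∑ i ∈ Finset.range L, 2 * |((c (T^[i] x) : ℕ) : ℝ) - f (T^[i] x)|) +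
            2 * ρ * L + (2 * K + 1) * warpCost T y L x) ∂ν := by
          refine integral_mono_of_nonneg (Eventually.of_forall fun x => by positivity)
            (h2i.add hwi) (Eventually.of_forall fun x => ?_)
          exact editCost_itinerary_le hK hf hW y x L
      _ = L * (2 * ∫ x, |((c x : ℕ) : ℝ) - f x| ∂ν) + 2 * ρ * L +
            (2 * K + 1) * ∫ x, warpCost T y L x ∂ν := by
          rw [integral_add h2i hwi, integral_add hsi (integrable_const _), hsum,
            integral_const_mul, integral_const_mul]
          simp [integral_const_mul]
      _ ≤ L * (2 * ρ) + 2 * ρ * L + (2 * K + 1) * (ρ / (2 * K + 1) * L) := by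
          gcongr
          exact hcost L
      _ = 5 * ρ * L := by
          field_simp
          ring
  have h5 : 5 * ρ * L * κ = 5 * (ζ / 8) * L := by
    rw [hρ]; field_simp
  have h6 := mul_le_mul_of_nonneg_right hle hκ0.le
  have h7 := mul_le_mul_of_nonneg_left hlog.le hL0.le
  nlinarith

lemma ShadowedByPeriodic.ksEntropy_eq_zero (hT : Continuous T)
    (hinv : MeasurePreserving T ν ν) (h : ShadowedByPeriodic T ν) : ksEntropy T ν = 0 := by
  refine le_antisymm (iSup_le fun m => iSup_le fun c => ?_) (zero_le)
  refine ENNReal.le_of_forall_pos_le_add fun ζ hζ _ => ?_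
  obtain ⟨n, hn⟩ := h.exists_sum_negMulLog_le hT hinv c.2 (ζ := ζ) hζ
  rw [zero_add]
  refine (iInf_le _ n).trans ?_
  rw [← ENNReal.ofReal_coe_nnreal]
  exact ENNReal.ofReal_le_ofReal hn

end ZeroEntropy

/-- If the orbit sequences of a sequence of `T`-periodic points form an
`F̄_K`-Cauchy sequence, then the associated periodic orbit measures converge weak-star to
a `T`-invariant ergodic probability measure of zero entropy. -/
theorem FKCauchy_periodic_orbits_limit_ergodic_zero_entropy
    {X : Type*} [MetricSpace X] [CompactSpace X] [MeasurableSpace X] [BorelSpace X]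
    (T : X → X) (hT : Continuous T)
    (ξ : ℕ → X) (π : ℕ → ℕ) (hπ : ∀ n, 0 < π n)
    (hper : ∀ n, T^[π n] (ξ n) = ξ n)
    (hcauchy : ∀ ε : ℝ, 0 < ε → ∃ n₀ : ℕ, ∀ m ≥ n₀, ∀ n ≥ n₀,
      FKdist dist (fun i => T^[i] (ξ n)) (fun i => T^[i] (ξ m)) < ε) :
    ∃ ν : Measure X, IsProbabilityMeasure ν ∧
      WeakStarTendsto
        (fun n => (π n : ℝ≥0∞)⁻¹ • ∑ ℓ ∈ Finset.range (π n), Measure.dirac (T^[ℓ] (ξ n))) ν ∧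
      MeasurePreserving T ν ν ∧ Ergodic T ν ∧ ksEntropy T ν = 0 := by
  have hprob := fun n => isProbabilityMeasure_inv_smul_sum_dirac T (ξ n) (hπ n)
  obtain ⟨ν, hν⟩ := exists_tendsto_integral_of_cauchySeq (fun n => ⟨_, hprob n⟩) (fun g => by
    simpa only [ProbabilityMeasure.coe_mk, integral_inv_smul_sum_dirac] using
      cauchySeq_orbitAvg hπ hper hcauchy g)
  have hlim : ∀ g : C(X, ℝ), Tendsto (fun n => orbitAvg T (ξ n) (π n) g) atTop
      (nhds (∫ x, g x ∂(ν : Measure X))) := fun g => by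
    simpa only [ProbabilityMeasure.coe_mk, integral_inv_smul_sum_dirac] using hν g
  have hinv : MeasurePreserving T (ν : Measure X) ν := by
    refine ⟨hT.measurable, ?_⟩
    have : IsProbabilityMeasure ((ν : Measure X).map T) :=
      Measure.isProbabilityMeasure_map hT.measurable.aemeasurable
    refine ext_of_forall_integral_eq_of_IsFiniteMeasure fun g => ?_
    rw [integral_map hT.measurable.aemeasurable g.continuous.aestronglyMeasurable]
    have h1 := hlim (g.toContinuousMap.comp ⟨T, hT⟩)
    have h2 : ∀ n, orbitAvg T (ξ n) (π n) (g.toContinuousMap.comp ⟨T, hT⟩) =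
        orbitAvg T (ξ n) (π n) g := fun n => orbitAvg_shift (hper n) g
    simp only [h2] at h1
    exact tendsto_nhds_unique h1 (hlim g.toContinuousMap)
  have hshadow : ShadowedByPeriodic T (ν : Measure X) := by
    intro ε hε
    obtain ⟨n₀, h⟩ := exists_orbitAvg_warpCost_le hπ hper hcauchy hε
    refine ⟨ξ n₀, π n₀, hπ n₀, hper n₀, fun L => ?_⟩
    refine le_of_tendsto (hlim ⟨warpCost T (ξ n₀) L, continuous_warpCost hT _ _⟩) ?_
    filter_upwards [eventually_ge_atTop n₀] with n hn using h n₀ le_rfl n hn L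
  exact ⟨ν, inferInstance, hν, hinv, hshadow.ergodic hT hinv, hshadow.ksEntropy_eq_zero hT hinv⟩

end
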